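/- Let r be a bounded progressively measurable spot-rate process with discount factor B(t,s) = e^{-∫_t^s r_u du}, let ξ be a bounded ℱ_T-measurable payoff, and let Z be a bounded ℱ-adapted recovery process such that s ↦ B(t,s)Z_s is a bounded càdlàg ℱ-martingale that almost surely does not jump at τ. Assume the hazard process is absolutely continuous, Γ_s = ∫_0^s λ_u du for a nonnegative progressively measurable intensity λ. Then the defaultable price c^d(t,T) = E[B(t,T) ξ 1_{τ>T} + B(t,τ) Z_τ 1_{t<τ≤T} | 𝒢_t] satisfies, almost surely, c^d(t,T) = 1_{τ>t} · E[ e^{-∫_t^T (r_s+λ_s) ds} ξ + ∫_t^T Z_s λ_s e^{-∫_t^s (r_u+λ_u) du} ds | ℱ_t ]. -/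

import Mathlib

open MeasureTheory

theorem AbsolutelyContinuousOnInterval.of_dist_le {f g : ℝ → ℝ} {a b : ℝ}
    (hf : AbsolutelyContinuousOnInterval f a b)
    (h : ∀ x ∈ Set.uIcc a b, ∀ y ∈ Set.uIcc a b, dist (g x) (g y) ≤ dist (f x) (f y)) :
    AbsolutelyContinuousOnInterval g a b := by
  refine squeeze_zero' (.of_forall fun E => Finset.sum_nonneg fun _ _ => dist_nonneg) ?_ hf
  refine Filter.eventually_inf_principal.2 (.of_forall fun E hE => Finset.sum_le_sum fun i hi => ?_)
  exact h _ (hE.1 i hi).1 _ (hE.1 i hi).2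

theorem abs_exp_neg_sub_exp_neg_le {x y : ℝ} (hx : 0 ≤ x) (hy : 0 ≤ y) :
    |Real.exp (-x) - Real.exp (-y)| ≤ |x - y| := by
  wlog hxy : x ≤ y generalizing x y
  · rw [abs_sub_comm, abs_sub_comm x]
    exact this hy hx (le_of_not_ge hxy)
  have h1 : Real.exp (-y) ≤ Real.exp (-x) := Real.exp_le_exp.2 (by linarith)
  have h2 : Real.exp (-y) = Real.exp (-x) * Real.exp (x - y) := by
    rw [← Real.exp_add]; congr 1; ring
  have h3 := Real.add_one_le_exp (x - y)
  have h4 : Real.exp (-x) ≤ 1 := Real.exp_le_one_iff.2 (by linarith)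
  have h5 := Real.exp_pos (-x)
  rw [abs_of_nonneg (by linarith), abs_of_nonpos (by linarith)]
  nlinarith

/-- The survival function `e^{-∫ l}` is an antiderivative of minus its density. -/
theorem integral_mul_exp_neg_primitive {l : ℝ → ℝ} (hl0 : ∀ s, 0 ≤ l s) {T a b : ℝ}
    (hl : IntegrableOn l (Set.Icc 0 T)) (ha : 0 ≤ a) (hab : a ≤ b) (hb : b ≤ T) :
    ∫ s in a..b, l s * Real.exp (-∫ u in (0 : ℝ)..s, l u) =
      Real.exp (-∫ u in (0 : ℝ)..a, l u) - Real.exp (-∫ u in (0 : ℝ)..b, l u) := by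
  have hb0 : 0 ≤ b := ha.trans hab
  have hint : IntervalIntegrable l volume 0 b :=
    (intervalIntegrable_iff_integrableOn_Icc_of_le hb0).2
      (hl.mono_set (Set.Icc_subset_Icc_right hb))
  have hsub : Set.uIcc a b ⊆ Set.uIcc 0 b := by
    rw [Set.uIcc_of_le hab, Set.uIcc_of_le hb0]; exact Set.Icc_subset_Icc_left ha
  have hac : AbsolutelyContinuousOnInterval
      (fun s => -Real.exp (-∫ u in (0 : ℝ)..s, l u)) a b := by
    refine AbsolutelyContinuousOnInterval.neg
      (AbsolutelyContinuousOnInterval.of_dist_le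
        ((hint.absolutelyContinuousOnInterval_intervalIntegral (c := 0) (by simp)).mono hsub) ?_)
    have hnn : ∀ x ∈ Set.uIcc a b, 0 ≤ ∫ u in (0 : ℝ)..x, l u := fun x hx => by
      rw [Set.uIcc_of_le hab] at hx
      exact intervalIntegral.integral_nonneg (ha.trans hx.1) fun u _ => hl0 u
    intro x hx y hy
    exact abs_exp_neg_sub_exp_neg_le (hnn x hx) (hnn y hy)
  have h := hac.integral_deriv_eq_sub
  rw [neg_sub_neg] at h
  rw [← h]
  refine intervalIntegral.integral_congr_ae ?_
  filter_upwards [hint.ae_hasDerivAt_integral] with x hx hxm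
  have hd := hx (hsub (Set.uIoc_subset_uIcc hxm)) 0 (by simp)
  rw [(show HasDerivAt (fun s => -Real.exp (-∫ u in (0 : ℝ)..s, l u)) _ x from
    hd.neg.exp.neg).deriv]
  simp [mul_comm]

/-- The `i`-th point of the uniform partition of `[t, T]` into `n + 1` intervals. -/
noncomputable def partitionPoint (t T : ℝ) (n i : ℕ) : ℝ := t + i * ((T - t) / (n + 1))

/-- The left-endpoint step approximation of `f` along the uniform partition of `(t, T]`. -/
noncomputable def leftStep (t T : ℝ) (n : ℕ) (f : ℝ → ℝ) (s : ℝ) : ℝ :=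
  ∑ i ∈ Finset.range (n + 1), f (partitionPoint t T n i) *
    (Set.Ioc (partitionPoint t T n i) (partitionPoint t T n (i + 1))).indicator 1 s

theorem partitionPoint_mono {t T : ℝ} (h : t ≤ T) (n : ℕ) : Monotone (partitionPoint t T n) := by
  intro i j hij
  have : 0 ≤ (T - t) / (n + 1) := div_nonneg (by linarith) (by positivity)
  unfold partitionPoint
  gcongr

theorem partitionPoint_zero (t T : ℝ) (n : ℕ) : partitionPoint t T n 0 = t := by
  simp [partitionPoint]

theorem partitionPoint_last (t T : ℝ) (n : ℕ) : partitionPoint t T n (n + 1) = T := by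
  unfold partitionPoint; push_cast; field_simp; ring

theorem partitionPoint_mem_Icc {t T : ℝ} (h : t ≤ T) {n i : ℕ} (hi : i ≤ n + 1) :
    partitionPoint t T n i ∈ Set.Icc t T := by
  constructor
  · simpa [partitionPoint_zero] using partitionPoint_mono h n (Nat.zero_le i)
  · simpa [partitionPoint_last] using partitionPoint_mono h n hi

theorem leftStep_of_notMem {t T : ℝ} (h : t ≤ T) (n : ℕ) (f : ℝ → ℝ) {s : ℝ}
    (hs : s ∉ Set.Ioc t T) : leftStep t T n f s = 0 := by
  refine Finset.sum_eq_zero fun i hi => ?_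
  have hi := Finset.mem_range.1 hi
  rw [Set.indicator_of_notMem, mul_zero]
  intro hmem
  exact hs ⟨(partitionPoint_mem_Icc h (by lia)).1.trans_lt hmem.1,
    hmem.2.trans (partitionPoint_mem_Icc h (by lia)).2⟩

theorem exists_leftStep_eq {t T : ℝ} (h : t ≤ T) (n : ℕ) (f : ℝ → ℝ) {s : ℝ}
    (hs : s ∈ Set.Ioc t T) :
    ∃ u ∈ Set.Icc t T, u < s ∧ s - (T - t) / (n + 1) ≤ u ∧ leftStep t T n f s = f u := by
  have hex : ∃ i, s ≤ partitionPoint t T n (i + 1) := ⟨n, by rw [partitionPoint_last]; exact hs.2⟩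
  classical
  set k := Nat.find hex with hk
  have hk1 : s ≤ partitionPoint t T n (k + 1) := Nat.find_spec hex
  have hkn : k ≤ n := Nat.find_min' hex (by rw [partitionPoint_last]; exact hs.2)
  have hk2 : partitionPoint t T n k < s := by
    rcases Nat.eq_zero_or_pos k with h0 | h0
    · rw [h0, partitionPoint_zero]; exact hs.1
    · have := Nat.find_min hex (m := k - 1) (by lia)
      rwa [not_le, Nat.sub_add_cancel h0] at this
  refine ⟨partitionPoint t T n k, partitionPoint_mem_Icc h (by lia), hk2, ?_, ?_⟩
  · have : partitionPoint t T n (k + 1) = partitionPoint t T n k + (T - t) / (n + 1) := by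
      unfold partitionPoint; push_cast; ring
    linarith
  · unfold leftStep
    rw [Finset.sum_eq_single k, Set.indicator_of_mem (Set.mem_Ioc.2 ⟨hk2, hk1⟩), Pi.one_apply, mul_one]
    · intro i _ hik
      rw [Set.indicator_of_notMem, mul_zero]
      rintro ⟨h1, h2⟩
      rcases lt_or_gt_of_ne hik with h3 | h3
      · exact absurd (h2.trans (partitionPoint_mono h n (show i + 1 ≤ k from h3))) (not_le.2 hk2)
      · exact absurd (hk1.trans (partitionPoint_mono h n (show k + 1 ≤ i from h3))) (not_le.2 h1)
    · intro hk'; exact absurd (Finset.mem_range.2 (by lia)) hk'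

theorem abs_leftStep_le {t T C : ℝ} (h : t ≤ T) (n : ℕ) {f : ℝ → ℝ}
    (hf : ∀ s ∈ Set.Icc t T, |f s| ≤ C) (s : ℝ) : |leftStep t T n f s| ≤ C := by
  by_cases hs : s ∈ Set.Ioc t T
  · obtain ⟨u, hu, -, -, he⟩ := exists_leftStep_eq h n f hs
    rw [he]; exact hf u hu
  · rw [leftStep_of_notMem h n f hs, abs_zero]
    exact (abs_nonneg _).trans (hf t (Set.left_mem_Icc.2 h))

theorem tendsto_leftStep {t T s L : ℝ} (hs : s ∈ Set.Ioc t T) {f : ℝ → ℝ}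
    (hf : Filter.Tendsto f (nhdsWithin s (Set.Iio s)) (nhds L)) :
    Filter.Tendsto (fun n => leftStep t T n f s) Filter.atTop (nhds L) := by
  have h : t ≤ T := (hs.1.trans_le hs.2).le
  choose u _ hus hsu hu using fun n => exists_leftStep_eq h n f hs
  simp_rw [hu]
  refine hf.comp (tendsto_nhdsWithin_iff.2 ⟨?_, .of_forall hus⟩)
  refine tendsto_of_tendsto_of_tendsto_of_le_of_le (g := fun n : ℕ => s - (T - t) / ((n : ℝ) + 1))
    ?_ tendsto_const_nhds hsu fun n => (hus n).le
  have : Filter.Tendsto (fun n : ℕ => (T - t) * (1 / ((n : ℝ) + 1))) Filter.atTop (nhds 0) := by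
    simpa using (tendsto_one_div_add_atTop_nhds_zero_nat (𝕜 := ℝ)).const_mul (T - t)
  simpa [div_eq_mul_inv] using tendsto_const_nhds (x := s) |>.sub this

theorem measurable_leftStep (t T : ℝ) (n : ℕ) (f : ℝ → ℝ) : Measurable (leftStep t T n f) :=
  Finset.measurable_fun_sum _ fun _ _ =>
    (measurable_one.indicator measurableSet_Ioc).const_mul _

/-- A function has only countably many points at which its left limit differs from its value. -/
theorem countable_setOf_leftLim_ne (f L : ℝ → ℝ) (S : Set ℝ)
    (hL : ∀ s ∈ S, Filter.Tendsto f (nhdsWithin s (Set.Iio s)) (nhds (L s))) :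
    {s ∈ S | L s ≠ f s}.Countable := by
  have key : ∀ p q : ℚ, ({s : ℝ | (q : ℝ) < s ∧ (p : ℝ) < f s ∧ ∀ y, (q : ℝ) < y → y < s → f y < p} ∪
      {s : ℝ | (q : ℝ) < s ∧ f s < (p : ℝ) ∧ ∀ y, (q : ℝ) < y → y < s → p < f y}).Countable := by
    intro p q
    refine (Set.Subsingleton.countable ?_).union (Set.Subsingleton.countable ?_)
    · intro x hx y hy
      rcases lt_trichotomy x y with h | h | h
      · exact absurd (hy.2.2 x hx.1 h) (not_lt.2 hx.2.1.le)
      · exact h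
      · exact absurd (hx.2.2 y hy.1 h) (not_lt.2 hy.2.1.le)
    · intro x hx y hy
      rcases lt_trichotomy x y with h | h | h
      · exact absurd (hy.2.2 x hx.1 h) (not_lt.2 hx.2.1.le)
      · exact h
      · exact absurd (hx.2.2 y hy.1 h) (not_lt.2 hy.2.1.le)
  refine (Set.countable_iUnion fun p => Set.countable_iUnion fun q => key p q).mono ?_
  rintro s ⟨hs, hne⟩
  simp only [Set.mem_iUnion]
  rcases lt_or_gt_of_ne hne with h | h
  · obtain ⟨p, hp1, hp2⟩ := exists_rat_btwn h
    obtain ⟨a, ha, hsub⟩ := mem_nhdsLT_iff_exists_Ioo_subset.1 ((hL s hs).eventually_lt_const hp1)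
    obtain ⟨q, hq1, hq2⟩ := exists_rat_btwn (Set.mem_Iio.1 ha)
    exact ⟨p, q, Or.inl ⟨hq2, hp2, fun y hy1 hy2 => hsub ⟨hq1.trans hy1, hy2⟩⟩⟩
  · obtain ⟨p, hp1, hp2⟩ := exists_rat_btwn h
    obtain ⟨a, ha, hsub⟩ := mem_nhdsLT_iff_exists_Ioo_subset.1 ((hL s hs).eventually_const_lt hp2)
    obtain ⟨q, hq1, hq2⟩ := exists_rat_btwn (Set.mem_Iio.1 ha)
    exact ⟨p, q, Or.inr ⟨hq2, hp1, fun y hy1 hy2 => hsub ⟨hq1.trans hy1, hy2⟩⟩⟩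

/-- The left-endpoint Riemann–Stieltjes sum of `f` against `1 - e^{-∫ l}`. -/
noncomputable def hazardSum (t T : ℝ) (n : ℕ) (f l : ℝ → ℝ) : ℝ :=
  ∑ i ∈ Finset.range (n + 1), f (partitionPoint t T n i) *
    (Real.exp (-∫ u in (0 : ℝ)..partitionPoint t T n i, l u) -
      Real.exp (-∫ u in (0 : ℝ)..partitionPoint t T n (i + 1), l u))

section HazardSum

variable {l : ℝ → ℝ} {t T : ℝ}

theorem continuousOn_exp_neg_primitive (ht : 0 ≤ t) (hl : IntegrableOn l (Set.Icc 0 T)) :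
    ContinuousOn (fun s => Real.exp (-∫ u in (0 : ℝ)..s, l u)) (Set.Icc t T) := by
  have := intervalIntegral.continuousOn_primitive_Icc hl
  have h2 := (this.mono (Set.Icc_subset_Icc_left ht)).neg.rexp
  refine h2.congr fun s hs => ?_
  simp only
  rw [intervalIntegral.integral_of_le (ht.trans hs.1), Pi.neg_apply, integral_Icc_eq_integral_Ioc]

theorem intervalIntegrable_mul_exp_neg_primitive (ht : 0 ≤ t) (htT : t ≤ T)
    (hl : IntegrableOn l (Set.Icc 0 T)) :
    IntervalIntegrable (fun s => l s * Real.exp (-∫ u in (0 : ℝ)..s, l u)) volume t T :=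
  (intervalIntegrable_iff_integrableOn_Icc_of_le htT).2 <|
    (hl.mono_set (Set.Icc_subset_Icc_left ht)).mul_continuousOn
      (continuousOn_exp_neg_primitive ht hl) isCompact_Icc

theorem hazardSum_eq_integral (hl0 : ∀ s, 0 ≤ l s) (ht : 0 ≤ t) (htT : t ≤ T)
    (hl : IntegrableOn l (Set.Icc 0 T)) (n : ℕ) (f : ℝ → ℝ) :
    hazardSum t T n f l =
      ∫ s in t..T, leftStep t T n f s * (l s * Real.exp (-∫ u in (0 : ℝ)..s, l u)) := by
  have hint := intervalIntegrable_mul_exp_neg_primitive ht htT hl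
  rw [intervalIntegrable_iff_integrableOn_Ioc_of_le htT] at hint
  rw [intervalIntegral.integral_of_le htT]
  unfold leftStep hazardSum
  simp_rw [Finset.sum_mul]
  have hterm : ∀ (i : ℕ) (s : ℝ), f (partitionPoint t T n i) *
      (Set.Ioc (partitionPoint t T n i) (partitionPoint t T n (i + 1))).indicator 1 s *
        (l s * Real.exp (-∫ u in (0 : ℝ)..s, l u)) = f (partitionPoint t T n i) *
      (Set.Ioc (partitionPoint t T n i) (partitionPoint t T n (i + 1))).indicator
        (fun s => l s * Real.exp (-∫ u in (0 : ℝ)..s, l u)) s := by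
    intro i s
    by_cases hs : s ∈ Set.Ioc (partitionPoint t T n i) (partitionPoint t T n (i + 1)) <;>
      simp [hs]
  simp_rw [hterm]
  rw [integral_finsetSum _ fun i _ => (hint.indicator measurableSet_Ioc).const_mul _]
  refine Finset.sum_congr rfl fun i hi => ?_
  have hi := Finset.mem_range.1 hi
  have h1 := partitionPoint_mem_Icc htT (show i ≤ n + 1 by lia)
  have h2 := partitionPoint_mem_Icc htT (show i + 1 ≤ n + 1 by lia)
  have h3 := partitionPoint_mono htT n (Nat.le_succ i)
  rw [integral_const_mul, integral_indicator measurableSet_Ioc,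
    Measure.restrict_restrict measurableSet_Ioc,
    Set.inter_eq_left.2 (Set.Ioc_subset_Ioc h1.1 h2.2), ← intervalIntegral.integral_of_le h3,
    integral_mul_exp_neg_primitive hl0 hl (ht.trans h1.1) h3 h2.2]

theorem abs_hazardSum_le (hl0 : ∀ s, 0 ≤ l s) (ht : 0 ≤ t) (htT : t ≤ T)
    (n : ℕ) {f : ℝ → ℝ} {C : ℝ} (hl : IntegrableOn l (Set.Icc 0 T))
    (hf : ∀ s ∈ Set.Icc t T, |f s| ≤ C) :
    |hazardSum t T n f l| ≤ C * Real.exp (-∫ u in (0 : ℝ)..t, l u) := by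
  have hC : 0 ≤ C := (abs_nonneg _).trans (hf t (Set.left_mem_Icc.2 htT))
  have hint := intervalIntegrable_mul_exp_neg_primitive ht htT hl
  rw [hazardSum_eq_integral hl0 ht htT hl]
  have h1 := intervalIntegral.norm_integral_le_of_norm_le htT (.of_forall fun s _ => ?_)
    (hint.const_mul C) (f := fun s =>
      leftStep t T n f s * (l s * Real.exp (-∫ u in (0 : ℝ)..s, l u)))
  · refine h1.trans ?_
    rw [intervalIntegral.integral_const_mul, integral_mul_exp_neg_primitive hl0 hl ht htT le_rfl]
    have h3 := Real.exp_pos (-∫ u in (0 : ℝ)..T, l u)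
    nlinarith
  · have := mul_nonneg (hl0 s) (Real.exp_pos (-∫ u in (0 : ℝ)..s, l u)).le
    rw [Real.norm_eq_abs, abs_mul, abs_of_nonneg this]
    exact mul_le_mul_of_nonneg_right (abs_leftStep_le htT n hf s) this

theorem tendsto_hazardSum (hl0 : ∀ s, 0 ≤ l s) (ht : 0 ≤ t) (htT : t ≤ T)
    {f : ℝ → ℝ} {C : ℝ} (hl : IntegrableOn l (Set.Icc 0 T))
    (hf : ∀ s ∈ Set.Icc t T, |f s| ≤ C)
    (hlim : ∀ u ∈ Set.Ioc t T, ∃ L, Filter.Tendsto f (nhdsWithin u (Set.Iio u)) (nhds L)) :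
    Filter.Tendsto (fun n => hazardSum t T n f l) Filter.atTop
      (nhds (∫ s in t..T, f s * (l s * Real.exp (-∫ u in (0 : ℝ)..s, l u)))) := by
  have hint := intervalIntegrable_mul_exp_neg_primitive ht htT hl
  simp_rw [hazardSum_eq_integral hl0 ht htT hl]
  choose! L hL using hlim
  have hae : ∀ᵐ s, s ∈ Set.Ioc t T → L s = f s := by
    have := (countable_setOf_leftLim_ne f L _ hL).ae_notMem volume
    filter_upwards [this] with s hs hm
    by_contra hne
    exact hs ⟨hm, hne⟩
  refine intervalIntegral.tendsto_integral_filter_of_dominated_convergence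
    (fun s => C * (l s * Real.exp (-∫ u in (0 : ℝ)..s, l u))) (.of_forall fun n => ?_)
    (.of_forall fun n => .of_forall fun s _ => ?_) (hint.const_mul C) ?_
  · refine (measurable_leftStep t T n f).aestronglyMeasurable.mul ?_
    rw [Set.uIoc_of_le htT]
    exact hint.1.aestronglyMeasurable
  · have := mul_nonneg (hl0 s) (Real.exp_pos (-∫ u in (0 : ℝ)..s, l u)).le
    rw [Real.norm_eq_abs, abs_mul, abs_of_nonneg this]
    exact mul_le_mul_of_nonneg_right (abs_leftStep_le htT n hf s) this
  · filter_upwards [hae] with s hs hm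
    rw [Set.uIoc_of_le htT] at hm
    rw [← hs hm]
    exact (tendsto_leftStep hm (hL s hm)).mul_const _

end HazardSum

section ProgressiveEnlargement

variable {Ω : Type*}

theorem MeasureTheory.IsStronglyProgressive.measurable_comp_min {mΩ : MeasurableSpace Ω}
    {ℱ : Filtration ℝ mΩ}
    {r : ℝ → Ω → ℝ} (hr : IsStronglyProgressive ℱ r) (s : ℝ) :
    StronglyMeasurable[(ℱ s).prod (borel ℝ)] fun p : Ω × ℝ => r (min p.2 s) p.1 := by
  let : MeasurableSpace Ω := ℱ s
  have hφ : Measurable fun p : Ω × ℝ =>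
      ((⟨min p.2 s, Set.mem_Iic.2 (min_le_right _ _)⟩ : Set.Iic s), p.1) :=
    ((measurable_snd.min measurable_const).subtype_mk).prodMk measurable_fst
  have := (hr s).comp_measurable hφ
  rwa [← BorelSpace.measurable_eq (α := ℝ)]

theorem MeasureTheory.IsStronglyProgressive.stronglyMeasurable_integral {mΩ : MeasurableSpace Ω}
    {ℱ : Filtration ℝ mΩ}
    {r : ℝ → Ω → ℝ} (hr : IsStronglyProgressive ℱ r) {a s : ℝ} (has : a ≤ s) :
    StronglyMeasurable[ℱ s] fun ω => ∫ u in a..s, r u ω := by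
  have h := hr.measurable_comp_min s
  rw [← BorelSpace.measurable_eq (α := ℝ)] at h
  have h2 := @StronglyMeasurable.integral_prod_right' Ω ℝ ℝ (ℱ s) _
    (volume.restrict (Set.Ioc a s)) _ _ _ _ h
  convert h2 using 2 with ω
  rw [intervalIntegral.integral_of_le has]
  exact setIntegral_congr_fun measurableSet_Ioc fun u hu => by
    simp only; rw [min_eq_left hu.2]

theorem MeasureTheory.IsStronglyProgressive.intervalIntegrable_of_bounded {mΩ : MeasurableSpace Ω}
    {ℱ : Filtration ℝ mΩ}
    {r : ℝ → Ω → ℝ} (hr : IsStronglyProgressive ℱ r) {C : ℝ} (hC : ∀ s ω, |r s ω| ≤ C)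
    {a s : ℝ} (has : a ≤ s) (ω : Ω) : IntervalIntegrable (fun u => r u ω) volume a s := by
  have h := hr.measurable_comp_min s
  rw [← BorelSpace.measurable_eq (α := ℝ)] at h
  have h2 : StronglyMeasurable fun u : ℝ => r (min u s) ω :=
    h.comp_measurable (@measurable_prodMk_left Ω ℝ (ℱ s) _ ω)
  rw [intervalIntegrable_iff_integrableOn_Ioc_of_le has]
  refine Integrable.of_bound ?_ C (.of_forall fun u => hC u ω)
  refine h2.aestronglyMeasurable.congr ?_
  filter_upwards [ae_restrict_mem measurableSet_Ioc] with u hu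
  rw [min_eq_left hu.2]

theorem setIntegral_mul_indicator_eq_of_condExp {m mΩ : MeasurableSpace Ω} {P : Measure Ω}
    [IsFiniteMeasure P] (hm : m ≤ mΩ)
    {f g : Ω → ℝ} (hf : StronglyMeasurable[m] f) (hfi : Integrable f P) {E : Set Ω}
    (hE : MeasurableSet E) (hg : g =ᵐ[P] P[E.indicator (fun _ => (1 : ℝ)) | m])
    {A : Set Ω} (hA : MeasurableSet[m] A) :
    ∫ ω in A, f ω * E.indicator (fun _ => (1 : ℝ)) ω ∂P = ∫ ω in A, f ω * g ω ∂P := by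
  have hEi : Integrable (E.indicator fun _ => (1 : ℝ)) P := (integrable_const 1).indicator hE
  have hfE : Integrable (f * E.indicator fun _ => (1 : ℝ)) P := by
    refine (hfi.indicator hE).congr (.of_forall fun ω => ?_)
    by_cases h : ω ∈ E <;> simp [h]
  have h1 := condExp_mul_of_stronglyMeasurable_left hf hfE hEi
  have h2 := setIntegral_condExp hm hfE hA
  simp only [Pi.mul_apply] at h2
  rw [← h2]
  refine setIntegral_congr_ae (hm A hA) ?_
  filter_upwards [h1, hg] with ω h3 h4 _
  rw [h3, Pi.mul_apply, h4]

theorem setIntegral_mul_indicator_compl_eq_of_condExp {m mΩ : MeasurableSpace Ω} {P : Measure Ω}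
    [IsFiniteMeasure P] (hm : m ≤ mΩ)
    {f g : Ω → ℝ} (hf : StronglyMeasurable[m] f) (hfi : Integrable f P) {E : Set Ω}
    (hE : MeasurableSet E) (hg : (fun ω => 1 - g ω) =ᵐ[P] P[E.indicator (fun _ => (1 : ℝ)) | m])
    {A : Set Ω} (hA : MeasurableSet[m] A) :
    ∫ ω in A, f ω * Eᶜ.indicator (fun _ => (1 : ℝ)) ω ∂P = ∫ ω in A, f ω * g ω ∂P := by
  refine setIntegral_mul_indicator_eq_of_condExp hm hf hfi hE.compl ?_ hA
  have hEi : Integrable (E.indicator fun _ => (1 : ℝ)) P := (integrable_const 1).indicator hE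
  have h1 : Eᶜ.indicator (fun _ => (1 : ℝ)) = (fun _ => (1 : ℝ)) - E.indicator fun _ => (1 : ℝ) := by
    ext ω; by_cases h : ω ∈ E <;> simp [h]
  rw [h1]
  have h2 := condExp_sub (integrable_const (μ := P) (1 : ℝ)) hEi m
  rw [condExp_const hm] at h2
  filter_upwards [h2, hg] with ω h3 h4
  rw [h3, Pi.sub_apply, ← h4]
  ring

/-- On `{t < τ}` the progressively enlarged σ-algebra at time `t` has the same traces as the
original one. -/
theorem exists_measurableSet_inter_eq {m : MeasurableSpace Ω} {τ : Ω → ℝ} {t : ℝ} {B : Set Ω}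
    (hB : MeasurableSet[m ⊔ MeasurableSpace.generateFrom {A | ∃ u ≤ t, A = {ω | τ ω ≤ u}}] B) :
    ∃ A, MeasurableSet[m] A ∧ B ∩ τ ⁻¹' Set.Ioi t = A ∩ τ ⁻¹' Set.Ioi t := by
  let m' : MeasurableSpace Ω :=
    { MeasurableSet' := fun B => ∃ A, MeasurableSet[m] A ∧ B ∩ τ ⁻¹' Set.Ioi t = A ∩ τ ⁻¹' Set.Ioi t
      measurableSet_empty := ⟨∅, MeasurableSet.empty, rfl⟩
      measurableSet_compl := by
        rintro B ⟨A, hA, h⟩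
        refine ⟨Aᶜ, hA.compl, ?_⟩
        ext ω
        have := Set.ext_iff.1 h ω
        simp only [Set.mem_inter_iff, Set.mem_compl_iff] at this ⊢
        tauto
      measurableSet_iUnion := by
        intro f hf
        choose A hA h using hf
        exact ⟨⋃ i, A i, MeasurableSet.iUnion hA, by simp_rw [Set.iUnion_inter, h]⟩ }
  have hle : m ⊔ MeasurableSpace.generateFrom {A | ∃ u ≤ t, A = {ω | τ ω ≤ u}} ≤ m' := by
    have h1 : m ≤ m' := fun A hA => ⟨A, hA, rfl⟩
    refine sup_le h1 (MeasurableSpace.generateFrom_le ?_)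
    rintro _ ⟨u, hu, rfl⟩
    refine ⟨∅, @MeasurableSet.empty _ m, ?_⟩
    ext ω
    simp only [Set.mem_inter_iff, Set.mem_ofPred_eq, Set.mem_preimage, Set.mem_Ioi,
      Set.mem_empty_iff_false, false_and, iff_false, not_and, not_lt]
    exact fun h => h.trans hu
  exact hle B hB

/-- The key lemma of progressive enlargement, for variables vanishing on `{τ ≤ t}`. -/
theorem condExp_enlargement_ae_eq {m 𝒢t mΩ : MeasurableSpace Ω} {P : Measure Ω}
    [IsFiniteMeasure P] {τ : Ω → ℝ} (hτ : Measurable τ) {t : ℝ}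
    (h𝒢 : 𝒢t = m ⊔ MeasurableSpace.generateFrom {A | ∃ u ≤ t, A = {ω | τ ω ≤ u}})
    (h𝒢le : 𝒢t ≤ mΩ) {X y : Ω → ℝ} (hX : Integrable X P) (hX0 : ∀ ω, τ ω ≤ t → X ω = 0)
    (hy : StronglyMeasurable[m] y) (hyi : Integrable y P)
    (h : ∀ A, MeasurableSet[m] A →
      ∫ ω in A, y ω * (τ ⁻¹' Set.Ioi t).indicator (fun _ => (1 : ℝ)) ω ∂P = ∫ ω in A, X ω ∂P) :
    P[X | 𝒢t] =ᵐ[P] fun ω => (τ ⁻¹' Set.Ioi t).indicator (fun _ => (1 : ℝ)) ω * y ω := by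
  have hE : MeasurableSet (τ ⁻¹' Set.Ioi t) := hτ measurableSet_Ioi
  have hE𝒢 : MeasurableSet[𝒢t] (τ ⁻¹' Set.Ioi t) := by
    have : MeasurableSet[𝒢t] {ω | τ ω ≤ t} := by
      rw [h𝒢]
      exact (le_sup_right : _ ≤ m ⊔ _) _ (MeasurableSpace.measurableSet_generateFrom ⟨t, le_rfl, rfl⟩)
    convert this.compl using 1
    ext ω; simp
  have hm𝒢 : m ≤ 𝒢t := h𝒢 ▸ le_sup_left
  have hint : Integrable (fun ω => (τ ⁻¹' Set.Ioi t).indicator (fun _ => (1 : ℝ)) ω * y ω) P := by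
    refine (hyi.indicator hE).congr (.of_forall fun ω => ?_)
    by_cases h : ω ∈ τ ⁻¹' Set.Ioi t <;> simp [h]
  refine (ae_eq_condExp_of_forall_setIntegral_eq h𝒢le hX (fun _ _ _ => hint.integrableOn)
    (fun B hB _ => ?_) ?_).symm
  · rw [h𝒢] at hB
    obtain ⟨A, hA, hAB⟩ := exists_measurableSet_inter_eq hB
    have key : ∀ f : Ω → ℝ, (∀ ω, τ ω ≤ t → f ω = 0) → ∫ ω in B, f ω ∂P = ∫ ω in A, f ω ∂P := by
      intro f hf
      classical
      rw [← integral_indicator (h𝒢le B (h𝒢 ▸ hB)), ← integral_indicator (h𝒢le A (hm𝒢 A hA))]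
      congr 1
      ext ω
      by_cases hω : τ ω ≤ t
      · simp [Set.indicator_apply, hf ω hω]
      · have : ω ∈ B ↔ ω ∈ A := by
          have := Set.ext_iff.1 hAB ω
          simpa [not_le.1 hω] using this
        simp [Set.indicator_apply, this]
    rw [key _ fun ω hω => ?_, key X hX0, ← h A hA]
    · simp_rw [mul_comm]
    · rw [Set.indicator_of_notMem (by simpa using hω), zero_mul]
  · exact ((stronglyMeasurable_const.indicator hE𝒢).mul (hy.mono hm𝒢)).aestronglyMeasurable

section Recovery

variable {mΩ : MeasurableSpace Ω} {P : Measure Ω} {ℱ : Filtration ℝ mΩ} {τ : Ω → ℝ} {l M : ℝ → Ω → ℝ} {t T C : ℝ}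

theorem setIntegral_leftStep_eq_hazardSum [IsFiniteMeasure P] (hτ : Measurable τ)
    (hl : IsStronglyProgressive ℱ l) (hl0 : ∀ s ω, 0 ≤ l s ω)
    (hF : ∀ s ∈ Set.Icc 0 T, (fun ω => 1 - Real.exp (-∫ u in (0 : ℝ)..s, l u ω)) =ᵐ[P]
      P[(τ ⁻¹' Set.Iic s).indicator (fun _ => (1 : ℝ)) | ℱ s])
    (ht : 0 ≤ t) (htT : t ≤ T) (hM : ∀ s ∈ Set.Icc t T, StronglyMeasurable[ℱ s] (M s))
    (hMC : ∀ s ∈ Set.Icc t T, ∀ ω, |M s ω| ≤ C) (n : ℕ) {A : Set Ω}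
    (hA : MeasurableSet[ℱ t] A) :
    ∫ ω in A, leftStep t T n (fun s => M s ω) (τ ω) ∂P =
      ∫ ω in A, hazardSum t T n (fun s => M s ω) (fun s => l s ω) ∂P := by
  have hMi : ∀ s ∈ Set.Icc t T, Integrable (M s) P := fun s hs =>
    Integrable.of_bound ((hM s hs).mono (ℱ.le s)).aestronglyMeasurable C (.of_forall (hMC s hs))
  have hind : ∀ s ∈ Set.Icc t T, ∀ u : ℝ, Integrable
      (fun ω => M s ω * (τ ⁻¹' Set.Iic u).indicator (fun _ => (1 : ℝ)) ω) P := by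
    intro s hs u
    refine ((hMi s hs).indicator (hτ measurableSet_Iic : MeasurableSet (τ ⁻¹' Set.Iic u))).congr
      (.of_forall fun ω => ?_)
    by_cases h : ω ∈ τ ⁻¹' Set.Iic u <;> simp [h]
  have hexp : ∀ s ∈ Set.Icc t T, ∀ u ∈ Set.Icc t T, Integrable
      (fun ω => M s ω * (1 - Real.exp (-∫ v in (0 : ℝ)..u, l v ω))) P := by
    intro s hs u hu
    have hu0 := ht.trans hu.1
    refine (hMi s hs).mul_bdd (c := 1) ?_ (.of_forall fun ω => ?_)
    · exact (stronglyMeasurable_const.sub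
        ((Real.continuous_exp.comp_stronglyMeasurable
          ((hl.stronglyMeasurable_integral hu0).mono (ℱ.le u)).neg))).aestronglyMeasurable
    · have h1 := Real.exp_pos (-∫ v in (0 : ℝ)..u, l v ω)
      have h2 : Real.exp (-∫ v in (0 : ℝ)..u, l v ω) ≤ 1 := Real.exp_le_one_iff.2
        (neg_nonpos.2 (intervalIntegral.integral_nonneg hu0 fun v _ => hl0 v ω))
      rw [Real.norm_eq_abs, abs_le]
      constructor <;> linarith
  have hstep : ∀ (i : ℕ) (ω : Ω), M (partitionPoint t T n i) ω *
      (Set.Ioc (partitionPoint t T n i) (partitionPoint t T n (i + 1))).indicator 1 (τ ω) =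
      M (partitionPoint t T n i) ω *
        (τ ⁻¹' Set.Iic (partitionPoint t T n (i + 1))).indicator (fun _ => (1 : ℝ)) ω -
      M (partitionPoint t T n i) ω *
        (τ ⁻¹' Set.Iic (partitionPoint t T n i)).indicator (fun _ => (1 : ℝ)) ω := by
    intro i ω
    have h3 := partitionPoint_mono htT n (Nat.le_succ i)
    rw [← mul_sub]
    congr 1
    classical
    simp only [Set.indicator_apply, Set.mem_Ioc, Set.mem_preimage, Set.mem_Iic, Pi.one_apply]
    grind
  have hsum : ∀ (i : ℕ) (ω : Ω), M (partitionPoint t T n i) ω *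
      (Real.exp (-∫ u in (0 : ℝ)..partitionPoint t T n i, l u ω) -
        Real.exp (-∫ u in (0 : ℝ)..partitionPoint t T n (i + 1), l u ω)) =
      M (partitionPoint t T n i) ω *
        (1 - Real.exp (-∫ u in (0 : ℝ)..partitionPoint t T n (i + 1), l u ω)) -
      M (partitionPoint t T n i) ω *
        (1 - Real.exp (-∫ u in (0 : ℝ)..partitionPoint t T n i, l u ω)) := by
    intro i ω; ring
  unfold leftStep hazardSum
  simp_rw [hstep, hsum]
  have hmem : ∀ i ∈ Finset.range (n + 1), partitionPoint t T n i ∈ Set.Icc t T ∧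
      partitionPoint t T n (i + 1) ∈ Set.Icc t T := fun i hi => by
    have := Finset.mem_range.1 hi
    exact ⟨partitionPoint_mem_Icc htT (by lia), partitionPoint_mem_Icc htT (by lia)⟩
  rw [integral_finsetSum, integral_finsetSum]
  rotate_left
  · exact fun i hi => ((hexp _ (hmem i hi).1 _ (hmem i hi).2).sub
      (hexp _ (hmem i hi).1 _ (hmem i hi).1)).integrableOn
  · exact fun i hi => ((hind _ (hmem i hi).1 _).sub (hind _ (hmem i hi).1 _)).integrableOn
  refine Finset.sum_congr rfl fun i hi => ?_
  obtain ⟨h1, h2⟩ := hmem i hi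
  have h3 := partitionPoint_mono htT n (Nat.le_succ i)
  rw [integral_sub (hind _ h1 _).integrableOn (hind _ h1 _).integrableOn,
    integral_sub (hexp _ h1 _ h2).integrableOn (hexp _ h1 _ h1).integrableOn]
  congr 1
  · exact setIntegral_mul_indicator_eq_of_condExp (ℱ.le _) ((hM _ h1).mono (ℱ.mono h3))
      (hMi _ h1) (hτ measurableSet_Iic) (hF _ ⟨ht.trans h2.1, h2.2⟩) (ℱ.mono h2.1 _ hA)
  · exact setIntegral_mul_indicator_eq_of_condExp (ℱ.le _) (hM _ h1)
      (hMi _ h1) (hτ measurableSet_Iic) (hF _ ⟨ht.trans h1.1, h1.2⟩) (ℱ.mono h1.1 _ hA)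

theorem measurable_leftStep_randomTime (hτ : Measurable τ)
    (htT : t ≤ T) (hM : ∀ s ∈ Set.Icc t T, StronglyMeasurable[ℱ s] (M s)) (n : ℕ) :
    Measurable fun ω => leftStep t T n (fun s => M s ω) (τ ω) := by
  refine Finset.measurable_fun_sum _ fun i hi => ?_
  have := Finset.mem_range.1 hi
  refine Measurable.mul ?_ ((measurable_one.indicator measurableSet_Ioc).comp hτ)
  exact ((hM _ (partitionPoint_mem_Icc htT (by lia))).mono (ℱ.le _)).measurable

theorem measurable_hazardSum (hl : IsStronglyProgressive ℱ l)
    (ht : 0 ≤ t) (htT : t ≤ T) (hM : ∀ s ∈ Set.Icc t T, StronglyMeasurable[ℱ s] (M s)) (n : ℕ) :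
    Measurable fun ω => hazardSum t T n (fun s => M s ω) (fun s => l s ω) := by
  have hexp : ∀ u ∈ Set.Icc t T, Measurable fun ω => Real.exp (-∫ v in (0 : ℝ)..u, l v ω) :=
    fun u hu => ((hl.stronglyMeasurable_integral (ht.trans hu.1)).mono (ℱ.le u)).measurable.neg.exp
  refine Finset.measurable_fun_sum _ fun i hi => ?_
  have := Finset.mem_range.1 hi
  have h1 := partitionPoint_mem_Icc htT (show i ≤ n + 1 by lia)
  have h2 := partitionPoint_mem_Icc htT (show i + 1 ≤ n + 1 by lia)
  exact ((hM _ h1).mono (ℱ.le _)).measurable.mul ((hexp _ h1).sub (hexp _ h2))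

theorem tendsto_leftStep_randomTime (htT : t ≤ T)
    (hjump : ∀ᵐ ω ∂P, Filter.Tendsto (fun s => M s ω)
      (nhdsWithin (τ ω) (Set.Iio (τ ω))) (nhds (M (τ ω) ω))) :
    ∀ᵐ ω ∂P, Filter.Tendsto (fun n => leftStep t T n (fun s => M s ω) (τ ω)) Filter.atTop
      (nhds ((τ ⁻¹' Set.Ioc t T).indicator (fun ω => M (τ ω) ω) ω)) := by
  filter_upwards [hjump] with ω hω
  by_cases h : τ ω ∈ Set.Ioc t T
  · rw [Set.indicator_of_mem (show ω ∈ τ ⁻¹' Set.Ioc t T from h)]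
    exact tendsto_leftStep h hω
  · rw [Set.indicator_of_notMem (show ω ∉ τ ⁻¹' Set.Ioc t T from h)]
    simp_rw [leftStep_of_notMem htT _ _ h]
    exact tendsto_const_nhds

theorem integrable_indicator_randomTime [IsFiniteMeasure P] (hτ : Measurable τ) (htT : t ≤ T)
    (hM : ∀ s ∈ Set.Icc t T, StronglyMeasurable[ℱ s] (M s))
    (hMC : ∀ s ∈ Set.Icc t T, ∀ ω, |M s ω| ≤ C)
    (hjump : ∀ᵐ ω ∂P, Filter.Tendsto (fun s => M s ω)
      (nhdsWithin (τ ω) (Set.Iio (τ ω))) (nhds (M (τ ω) ω))) :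
    Integrable ((τ ⁻¹' Set.Ioc t T).indicator fun ω => M (τ ω) ω) P := by
  refine Integrable.of_bound (aestronglyMeasurable_of_tendsto_ae Filter.atTop
    (fun n => (measurable_leftStep_randomTime hτ htT hM n).aestronglyMeasurable)
    (tendsto_leftStep_randomTime htT hjump)) C ?_
  filter_upwards [tendsto_leftStep_randomTime htT hjump] with ω hω
  exact le_of_tendsto hω.norm (.of_forall fun n => abs_leftStep_le htT n (fun s hs => hMC s hs ω) _)

theorem abs_integral_hazard_le (hl0 : ∀ s ω, 0 ≤ l s ω) (ht : 0 ≤ t) (htT : t ≤ T)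
    (hli : ∀ᵐ ω ∂P, IntegrableOn (fun u => l u ω) (Set.Icc 0 T))
    (hMC : ∀ s ∈ Set.Icc t T, ∀ ω, |M s ω| ≤ C)
    (hlim : ∀ ω, ∀ u ∈ Set.Ioc t T,
      ∃ L, Filter.Tendsto (fun s => M s ω) (nhdsWithin u (Set.Iio u)) (nhds L)) :
    ∀ᵐ ω ∂P, |∫ s in t..T, M s ω * (l s ω * Real.exp (-∫ u in (0 : ℝ)..s, l u ω))| ≤
      C * Real.exp (-∫ u in (0 : ℝ)..t, l u ω) := by
  filter_upwards [hli] with ω hω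
  exact le_of_tendsto (tendsto_hazardSum (fun s => hl0 s ω) ht htT hω
    (fun s hs => hMC s hs ω) (hlim ω)).abs
    (.of_forall fun n => abs_hazardSum_le (fun s => hl0 s ω) ht htT n hω fun s hs => hMC s hs ω)

theorem exp_neg_primitive_le_one {f : ℝ → ℝ} (hf : ∀ s, 0 ≤ f s) (ht : 0 ≤ t) :
    Real.exp (-∫ u in (0 : ℝ)..t, f u) ≤ 1 :=
  Real.exp_le_one_iff.2 (neg_nonpos.2 (intervalIntegral.integral_nonneg ht fun u _ => hf u))

theorem aestronglyMeasurable_integral_hazard (hl : IsStronglyProgressive ℱ l)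
    (hl0 : ∀ s ω, 0 ≤ l s ω) (ht : 0 ≤ t) (htT : t ≤ T)
    (hli : ∀ᵐ ω ∂P, IntegrableOn (fun u => l u ω) (Set.Icc 0 T))
    (hM : ∀ s ∈ Set.Icc t T, StronglyMeasurable[ℱ s] (M s))
    (hMC : ∀ s ∈ Set.Icc t T, ∀ ω, |M s ω| ≤ C)
    (hlim : ∀ ω, ∀ u ∈ Set.Ioc t T,
      ∃ L, Filter.Tendsto (fun s => M s ω) (nhdsWithin u (Set.Iio u)) (nhds L)) :
    AEStronglyMeasurable (fun ω =>
      ∫ s in t..T, M s ω * (l s ω * Real.exp (-∫ u in (0 : ℝ)..s, l u ω))) P := by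
  refine aestronglyMeasurable_of_tendsto_ae Filter.atTop
    (fun n => (measurable_hazardSum hl ht htT hM n).aestronglyMeasurable) ?_
  filter_upwards [hli] with ω hω
  exact tendsto_hazardSum (fun s => hl0 s ω) ht htT hω (fun s hs => hMC s hs ω) (hlim ω)

/-- The value of a process at the random time `τ` is integrated against the hazard rate. -/
theorem setIntegral_indicator_randomTime_eq [IsFiniteMeasure P] (hτ : Measurable τ)
    (hl : IsStronglyProgressive ℱ l) (hl0 : ∀ s ω, 0 ≤ l s ω)
    (hli : ∀ᵐ ω ∂P, IntegrableOn (fun u => l u ω) (Set.Icc 0 T))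
    (hF : ∀ s ∈ Set.Icc 0 T, (fun ω => 1 - Real.exp (-∫ u in (0 : ℝ)..s, l u ω)) =ᵐ[P]
      P[(τ ⁻¹' Set.Iic s).indicator (fun _ => (1 : ℝ)) | ℱ s])
    (ht : 0 ≤ t) (htT : t ≤ T) (hM : ∀ s ∈ Set.Icc t T, StronglyMeasurable[ℱ s] (M s))
    (hMC : ∀ s ∈ Set.Icc t T, ∀ ω, |M s ω| ≤ C)
    (hlim : ∀ ω, ∀ u ∈ Set.Ioc t T,
      ∃ L, Filter.Tendsto (fun s => M s ω) (nhdsWithin u (Set.Iio u)) (nhds L))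
    (hjump : ∀ᵐ ω ∂P, Filter.Tendsto (fun s => M s ω)
      (nhdsWithin (τ ω) (Set.Iio (τ ω))) (nhds (M (τ ω) ω)))
    {A : Set Ω} (hA : MeasurableSet[ℱ t] A) :
    ∫ ω in A, (τ ⁻¹' Set.Ioc t T).indicator (fun ω => M (τ ω) ω) ω ∂P =
      ∫ ω in A, (∫ s in t..T, M s ω * (l s ω * Real.exp (-∫ u in (0 : ℝ)..s, l u ω))) ∂P := by
  have h1 : Filter.Tendsto
      (fun n => ∫ ω in A, leftStep t T n (fun s => M s ω) (τ ω) ∂P) Filter.atTop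
      (nhds (∫ ω in A, (τ ⁻¹' Set.Ioc t T).indicator (fun ω => M (τ ω) ω) ω ∂P)) :=
    tendsto_integral_of_dominated_convergence (fun _ => C)
      (fun n => (measurable_leftStep_randomTime hτ htT hM n).aestronglyMeasurable)
      (integrable_const C)
      (fun n => .of_forall fun ω => abs_leftStep_le htT n (fun s hs => hMC s hs ω) _)
      (ae_restrict_of_ae (tendsto_leftStep_randomTime htT hjump))
  have h2 : Filter.Tendsto
      (fun n => ∫ ω in A, hazardSum t T n (fun s => M s ω) (fun s => l s ω) ∂P) Filter.atTop
      (nhds (∫ ω in A, (∫ s in t..T,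
        M s ω * (l s ω * Real.exp (-∫ u in (0 : ℝ)..s, l u ω))) ∂P)) := by
    refine tendsto_integral_of_dominated_convergence (fun _ => C)
      (fun n => (measurable_hazardSum hl ht htT hM n).aestronglyMeasurable)
      (integrable_const C) (fun n => ae_restrict_of_ae ?_) (ae_restrict_of_ae ?_)
    · filter_upwards [hli] with ω hω
      have hC : 0 ≤ C := (abs_nonneg _).trans (hMC t (Set.left_mem_Icc.2 htT) ω)
      exact (abs_hazardSum_le (fun s => hl0 s ω) ht htT n hω fun s hs => hMC s hs ω).trans
        (mul_le_of_le_one_right hC (exp_neg_primitive_le_one (fun s => hl0 s ω) ht))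
    · filter_upwards [hli] with ω hω
      exact tendsto_hazardSum (fun s => hl0 s ω) ht htT hω (fun s hs => hMC s hs ω) (hlim ω)
  simp_rw [setIntegral_leftStep_eq_hazardSum hτ hl hl0 hF ht htT hM hMC _ hA] at h1
  exact tendsto_nhds_unique h1 h2

end Recovery

end ProgressiveEnlargement

theorem discountedPayoff_eq {r l z : ℝ → ℝ} {t T : ℝ} (x : ℝ) (ht : 0 ≤ t) (htT : t ≤ T)
    (hr : ∀ s ∈ Set.Icc t T, IntervalIntegrable r volume t s)
    (hl : IntegrableOn l (Set.Icc 0 T)) :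
    Real.exp (-(∫ s in t..T, (r s + l s))) * x +
        ∫ s in t..T, z s * l s * Real.exp (-(∫ u in t..s, (r u + l u))) =
      Real.exp (∫ u in (0 : ℝ)..t, l u) *
        (Real.exp (-(∫ u in t..T, r u)) * x * Real.exp (-∫ u in (0 : ℝ)..T, l u) +
          ∫ s in t..T, (Real.exp (-(∫ u in t..s, r u)) * z s) *
            (l s * Real.exp (-∫ u in (0 : ℝ)..s, l u))) := by
  have hl' : ∀ a b, 0 ≤ a → a ≤ b → b ≤ T → IntervalIntegrable l volume a b := fun a b ha hab hb =>
    (intervalIntegrable_iff_integrableOn_Ioc_of_le hab).2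
      (hl.mono_set fun u hu => ⟨ha.trans hu.1.le, hu.2.trans hb⟩)
  have key : ∀ s ∈ Set.Icc t T, Real.exp (-(∫ u in t..s, (r u + l u))) =
      Real.exp (∫ u in (0 : ℝ)..t, l u) *
        (Real.exp (-(∫ u in t..s, r u)) * Real.exp (-∫ u in (0 : ℝ)..s, l u)) := by
    intro s hs
    rw [intervalIntegral.integral_add (hr s hs) (hl' t s ht hs.1 hs.2),
      ← intervalIntegral.integral_add_adjacent_intervals (hl' 0 t le_rfl ht htT)
        (hl' t s ht hs.1 hs.2), ← Real.exp_add, ← Real.exp_add]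
    congr 1
    ring
  rw [mul_add, ← intervalIntegral.integral_const_mul, key T ⟨htT, le_rfl⟩]
  congr 1
  · ring
  · refine intervalIntegral.integral_congr fun s hs => ?_
    rw [Set.uIcc_of_le htT] at hs
    simp only [key s hs]
    ring

/-- Lando's formula: under an absolutely continuous hazard process `Γ_s = ∫_0^s λ_u du`,
for a bounded progressively measurable spot rate `r` with discount factor
`B(t,s) = e^{-∫_t^s r_u du}`, a bounded `ℱ_T`-measurable payoff `ξ` and a bounded
`ℱ`-adapted recovery process `Z` such that `s ↦ B(t,s)Z_s` is a bounded càdlàg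
`ℱ`-martingale on `[t,T]` that a.s. does not jump at `τ`, the defaultable price
`c^d(t,T) = E[B(t,T) ξ 1_{τ>T} + B(t,τ) Z_τ 1_{t<τ≤T} | 𝒢_t]` satisfies a.s.
`c^d(t,T) = 1_{τ>t} · E[ e^{-∫_t^T (r+λ)} ξ + ∫_t^T Z_s λ_s e^{-∫_t^s (r+λ)} ds | ℱ_t ]`. -/
theorem stmt6
    {Ω : Type*} {mΩ : MeasurableSpace Ω} (P : Measure Ω) [IsProbabilityMeasure P]
    (T : ℝ) (hT : 0 ≤ T)
    (ℱ : Filtration ℝ mΩ)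
    (τ : Ω → ℝ) (hτmeas : Measurable τ) (hτpos : ∀ ω, 0 < τ ω)
    (𝒢 : ℝ → MeasurableSpace Ω)
    (h𝒢 : ∀ s, 𝒢 s = (ℱ s : MeasurableSpace Ω) ⊔
      MeasurableSpace.generateFrom {A | ∃ u ≤ s, A = {ω | τ ω ≤ u}})
    (h𝒢le : ∀ s, 𝒢 s ≤ mΩ)
    -- bounded progressively measurable spot rate
    (r : ℝ → Ω → ℝ) (hr_prog : ProgMeasurable ℱ r)
    (hr_bdd : ∃ C, ∀ s ω, |r s ω| ≤ C)
    -- nonnegative progressively measurable intensity, locally integrable in time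
    (lam : ℝ → Ω → ℝ) (hlam_nonneg : ∀ s ω, 0 ≤ lam s ω)
    (hlam_prog : ProgMeasurable ℱ lam)
    (hlam_int : ∀ᵐ ω ∂P, IntegrableOn (fun u => lam u ω) (Set.Icc 0 T) volume)
    -- the hazard process `Γ_s = -ln(1 - F_s)` is absolutely continuous with density `λ`
    (Γ : ℝ → Ω → ℝ)
    (hΓ : ∀ᵐ ω ∂P, ∀ s ∈ Set.Icc (0 : ℝ) T, Γ s ω = ∫ u in (0 : ℝ)..s, lam u ω)
    (hFΓ : ∀ s, (fun ω => 1 - Real.exp (-Γ s ω)) =ᵐ[P]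
      P[Set.indicator (τ ⁻¹' Set.Iic s) (fun _ => (1 : ℝ)) | ℱ s])
    (t : ℝ) (ht : 0 ≤ t) (htT : t ≤ T)
    -- bounded `ℱ_T`-measurable payoff
    (ξ : Ω → ℝ) (hξmeas : StronglyMeasurable[ℱ T] ξ) (hξbdd : ∃ C, ∀ ω, |ξ ω| ≤ C)
    -- bounded `ℱ`-adapted recovery process
    (Z : ℝ → Ω → ℝ) (hZ_adapted : Adapted ℱ Z) (hZ_bdd : ∃ C, ∀ s ω, |Z s ω| ≤ C)
    -- the discounted recovery process `MZ s = B(t,s) Z_s`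
    (MZ : ℝ → Ω → ℝ)
    (hMZ : ∀ s ω, MZ s ω = Real.exp (-(∫ u in t..s, r u ω)) * Z s ω)
    -- ... is a bounded càdlàg `ℱ`-martingale on `[t,T]` ...
    (hMZ_bdd : ∃ C, ∀ s ∈ Set.Icc t T, ∀ ω, |MZ s ω| ≤ C)
    (hMZ_mart : ∀ u ∈ Set.Icc t T, ∀ v ∈ Set.Icc t T, u ≤ v →
      P[MZ v | ℱ u] =ᵐ[P] MZ u)
    (hMZ_rc : ∀ ω, ∀ u ∈ Set.Ico t T,
      ContinuousWithinAt (fun s => MZ s ω) (Set.Icc u T) u)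
    (hMZ_ll : ∀ ω, ∀ u ∈ Set.Ioc t T,
      ∃ l, Filter.Tendsto (fun s => MZ s ω) (nhdsWithin u (Set.Iio u)) (nhds l))
    -- ... that almost surely does not jump at `τ`
    (hMZ_nojump : ∀ᵐ ω ∂P, Filter.Tendsto (fun s => MZ s ω)
      (nhdsWithin (τ ω) (Set.Iio (τ ω))) (nhds (MZ (τ ω) ω))) :
    P[fun ω => Real.exp (-(∫ u in t..T, r u ω)) * ξ ω *
          Set.indicator (τ ⁻¹' Set.Ioi T) (fun _ => (1 : ℝ)) ω
        + Set.indicator (τ ⁻¹' Set.Ioc t T)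
            (fun ω' => Real.exp (-(∫ u in t..(τ ω'), r u ω')) * Z (τ ω') ω') ω | 𝒢 t]
      =ᵐ[P] fun ω => Set.indicator (τ ⁻¹' Set.Ioi t) (fun _ => (1 : ℝ)) ω *
        (P[fun ω' => Real.exp (-(∫ s in t..T, (r s ω' + lam s ω'))) * ξ ω'
            + ∫ s in t..T, Z s ω' * lam s ω' *
                Real.exp (-(∫ u in t..s, (r u ω' + lam u ω'))) | ℱ t]) ω := by
  obtain ⟨Cr, hCr⟩ := hr_bdd
  obtain ⟨Cξ, hCξ⟩ := hξbdd
  obtain ⟨C, hC⟩ := hMZ_bdd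
  have hr : IsStronglyProgressive ℱ r := hr_prog
  have hl : IsStronglyProgressive ℱ lam := hlam_prog
  have hF : ∀ s ∈ Set.Icc 0 T, (fun ω => 1 - Real.exp (-∫ u in (0 : ℝ)..s, lam u ω)) =ᵐ[P]
      P[(τ ⁻¹' Set.Iic s).indicator (fun _ => (1 : ℝ)) | ℱ s] := by
    intro s hs
    filter_upwards [hFΓ s, hΓ] with ω h1 h2
    rw [← h1, h2 s hs]
  have hM : ∀ s ∈ Set.Icc t T, StronglyMeasurable[ℱ s] (MZ s) := by
    intro s hs
    have h1 : MZ s = fun ω => Real.exp (-(∫ u in t..s, r u ω)) * Z s ω := funext (hMZ s)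
    rw [h1]
    have h2 := (hr.stronglyMeasurable_integral hs.1).measurable
    exact (h2.neg.exp.mul (hZ_adapted s)).stronglyMeasurable
  let Λ : ℝ → Ω → ℝ := fun s ω => ∫ u in (0 : ℝ)..s, lam u ω
  let D : Ω → ℝ := fun ω => Real.exp (-(∫ u in t..T, r u ω)) * ξ ω
  let R : Ω → ℝ := fun ω => ∫ s in t..T, MZ s ω * (lam s ω * Real.exp (-Λ s ω))
  let I : Ω → ℝ := (τ ⁻¹' Set.Ioc t T).indicator fun ω => MZ (τ ω) ω
  let Y : Ω → ℝ := fun ω => Real.exp (-(∫ s in t..T, (r s ω + lam s ω))) * ξ ω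
            + ∫ s in t..T, Z s ω * lam s ω *
                Real.exp (-(∫ u in t..s, (r u ω + lam u ω)))
  have hΛ : ∀ s, 0 ≤ s → StronglyMeasurable[ℱ s] fun ω => Real.exp (-Λ s ω) := fun s hs =>
    (hl.stronglyMeasurable_integral hs).measurable.neg.exp.stronglyMeasurable
  have hD : StronglyMeasurable[ℱ T] D :=
    ((hr.stronglyMeasurable_integral htT).measurable.neg.exp.mul hξmeas.measurable).stronglyMeasurable
  have hDb : ∀ ω, |D ω| ≤ Real.exp (Cr * |T - t|) * Cξ := by
    intro ω
    have h1 : ‖∫ u in t..T, r u ω‖ ≤ Cr * |T - t| :=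
      intervalIntegral.norm_integral_le_of_norm_le_const fun u _ => hCr u ω
    rw [abs_mul, Real.abs_exp]
    refine mul_le_mul (Real.exp_le_exp.2 ?_) (hCξ ω) (abs_nonneg _) (Real.exp_nonneg _)
    exact (neg_le_abs _).trans h1
  have hDi : Integrable D P :=
    Integrable.of_bound (hD.mono (ℱ.le T)).aestronglyMeasurable _ (.of_forall hDb)
  have hIi : Integrable I P := integrable_indicator_randomTime hτmeas htT hM hC hMZ_nojump
  have hDτ : Integrable (fun ω => D ω * (τ ⁻¹' Set.Ioi T).indicator (fun _ => (1 : ℝ)) ω) P := by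
    refine (hDi.indicator (hτmeas (measurableSet_Ioi (a := T)))).congr (.of_forall fun ω => ?_)
    by_cases h : ω ∈ τ ⁻¹' Set.Ioi T <;> simp [h]
  have hRm : AEStronglyMeasurable R P :=
    aestronglyMeasurable_integral_hazard hl hlam_nonneg ht htT hlam_int hM hC hMZ_ll
  have hRb : ∀ᵐ ω ∂P, |R ω| ≤ C * Real.exp (-Λ t ω) :=
    abs_integral_hazard_le hlam_nonneg ht htT hlam_int hC hMZ_ll
  have hC0 : 0 ≤ C := by
    obtain ⟨ω⟩ := P.nonempty_of_neZero
    exact (abs_nonneg _).trans (hC t ⟨le_rfl, htT⟩ ω)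
  have hRi : Integrable R P := by
    refine Integrable.of_bound hRm C ?_
    filter_upwards [hRb] with ω hω
    exact hω.trans (mul_le_of_le_one_right hC0 (exp_neg_primitive_le_one (hlam_nonneg · ω) ht))
  have hDΛi : Integrable (fun ω => D ω * Real.exp (-Λ T ω)) P := by
    refine hDi.mul_bdd (c := 1) ((hΛ T hT).mono (ℱ.le T)).aestronglyMeasurable
      (.of_forall fun ω => ?_)
    rw [Real.norm_eq_abs, Real.abs_exp]
    exact exp_neg_primitive_le_one (hlam_nonneg · ω) hT
  have hYeq : ∀ᵐ ω ∂P, Y ω = Real.exp (Λ t ω) * (D ω * Real.exp (-Λ T ω) + R ω) := by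
    filter_upwards [hlam_int] with ω hω
    simp only [Y, D, R, Λ, hMZ]
    exact discountedPayoff_eq (ξ ω) ht htT
      (fun s hs => hr.intervalIntegrable_of_bounded hCr hs.1 ω) hω
  have hΛY : ∀ᵐ ω ∂P, Real.exp (-Λ t ω) * Y ω = D ω * Real.exp (-Λ T ω) + R ω := by
    filter_upwards [hYeq] with ω hω
    rw [hω, ← mul_assoc, ← Real.exp_add, neg_add_cancel, Real.exp_zero, one_mul]
  have hYi : Integrable Y P := by
    have hΛt := (((hΛ t ht).mono (ℱ.le t)).measurable.inv).aestronglyMeasurable (μ := P)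
    refine Integrable.of_bound ((hΛt.mul (hDΛi.aestronglyMeasurable.add hRm)).congr ?_)
      (Real.exp (Cr * |T - t|) * Cξ + C) ?_
    · filter_upwards [hYeq] with ω hω
      simp [hω, Real.exp_neg]
    · filter_upwards [hYeq, hRb, hlam_int] with ω h1 h2 h3
      have h4 : Λ t ω ≤ Λ T ω :=
        intervalIntegral.integral_mono_interval le_rfl ht htT (.of_forall (hlam_nonneg · ω))
          ((intervalIntegrable_iff_integrableOn_Icc_of_le hT).2 h3)
      rw [h1, Real.norm_eq_abs, mul_add]
      refine (abs_add_le _ _).trans (add_le_add ?_ ?_)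
      · rw [mul_left_comm, ← Real.exp_add, abs_mul, Real.abs_exp]
        refine (mul_le_of_le_one_right (abs_nonneg _) (Real.exp_le_one_iff.2 ?_)).trans (hDb ω)
        linarith
      · rw [abs_mul, Real.abs_exp]
        refine (mul_le_mul_of_nonneg_left h2 (Real.exp_nonneg _)).trans_eq ?_
        rw [mul_left_comm, ← Real.exp_add, add_neg_cancel, Real.exp_zero, mul_one]
  have hX : (fun ω => Real.exp (-(∫ u in t..T, r u ω)) * ξ ω *
          Set.indicator (τ ⁻¹' Set.Ioi T) (fun _ => (1 : ℝ)) ω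
        + Set.indicator (τ ⁻¹' Set.Ioc t T)
            (fun ω' => Real.exp (-(∫ u in t..(τ ω'), r u ω')) * Z (τ ω') ω') ω) =
      fun ω => D ω * (τ ⁻¹' Set.Ioi T).indicator (fun _ => (1 : ℝ)) ω + I ω := by
    simp only [D, I, hMZ]
  rw [hX]
  refine condExp_enlargement_ae_eq hτmeas (h𝒢 t) (h𝒢le t) (hDτ.add hIi) ?_
    stronglyMeasurable_condExp integrable_condExp ?_
  · intro ω hω
    have h1 : ω ∉ τ ⁻¹' Set.Ioi T := fun h => (hω.trans htT).not_gt h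
    have h2 : ω ∉ τ ⁻¹' Set.Ioc t T := fun h => hω.not_gt h.1
    simp [I, Set.indicator_of_notMem h1, Set.indicator_of_notMem h2]
  · intro A hA
    have hcompl : ∀ s, τ ⁻¹' Set.Ioi s = (τ ⁻¹' Set.Iic s)ᶜ := fun s => by
      rw [← Set.preimage_compl, Set.compl_Iic]
    have hpull : P[fun ω => Real.exp (-Λ t ω) * Y ω | ℱ t] =ᵐ[P]
        fun ω => Real.exp (-Λ t ω) * P[Y | ℱ t] ω :=
      condExp_stronglyMeasurable_mul_of_bound (ℱ.le t) (hΛ t ht) hYi 1 (.of_forall fun ω => by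
        rw [Real.norm_eq_abs, Real.abs_exp]
        exact exp_neg_primitive_le_one (hlam_nonneg · ω) ht)
    calc ∫ ω in A, P[Y | ℱ t] ω * (τ ⁻¹' Set.Ioi t).indicator (fun _ => (1 : ℝ)) ω ∂P
        = ∫ ω in A, P[Y | ℱ t] ω * Real.exp (-Λ t ω) ∂P := by
          rw [hcompl]
          exact setIntegral_mul_indicator_compl_eq_of_condExp (ℱ.le t) stronglyMeasurable_condExp
            integrable_condExp (hτmeas measurableSet_Iic) (hF t ⟨ht, htT⟩) hA
      _ = ∫ ω in A, P[fun ω => Real.exp (-Λ t ω) * Y ω | ℱ t] ω ∂P := by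
          refine setIntegral_congr_ae (ℱ.le t A hA) ?_
          filter_upwards [hpull] with ω hω _
          rw [hω, mul_comm]
      _ = ∫ ω in A, (D ω * Real.exp (-Λ T ω) + R ω) ∂P := by
          rw [setIntegral_condExp (ℱ.le t) ((hDΛi.add hRi).congr (hΛY.mono fun ω hω => hω.symm)) hA]
          refine setIntegral_congr_ae (ℱ.le t A hA) ?_
          filter_upwards [hΛY] with ω hω _
          exact hω
      _ = ∫ ω in A, D ω * (τ ⁻¹' Set.Ioi T).indicator (fun _ => (1 : ℝ)) ω + I ω ∂P := by
          rw [integral_add hDΛi.integrableOn hRi.integrableOn,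
            integral_add hDτ.integrableOn hIi.integrableOn, hcompl,
            setIntegral_mul_indicator_compl_eq_of_condExp (ℱ.le T) hD hDi
              (hτmeas measurableSet_Iic) (hF T ⟨hT, le_rfl⟩) (ℱ.mono htT A hA),
            setIntegral_indicator_randomTime_eq hτmeas hl hlam_nonneg hlam_int hF ht htT hM hC
              hMZ_ll hMZ_nojump hA]
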